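/- arXiv:1105.3781 — 4 statements merged into one kernel-verified Lean document; each statement's English description precedes it below -/
import Mathlib

section
/- Let (Ω, 𝒜, ν) be a probability space and H = L²(Ω, ν). For every fixed B ∈ 𝒜, the map A ↦ D(A,B) is a countably additive operator-valued measure: if (A_i) is a sequence of mutually disjoint events in 𝒜, then ∑_{i=1}^∞ D(A_i, B) converges in the operator norm topology to D(∪_i A_i, B). -/
open MeasureTheory

noncomputable def chi {Ω : Type*} [MeasurableSpace Ω] (ν : Measure Ω) [IsFiniteMeasure ν]
    {A : Set Ω} (hA : MeasurableSet A) : Lp ℂ 2 ν :=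
  indicatorConstLp 2 hA (measure_ne_top ν A) (1 : ℂ)

/-- The decoherence operator `D(A,B) : g ↦ ⟪χ_B, g⟫ • χ_A`, i.e. `(D(A,B)g)(y) = (∫_B g dν)·χ_A(y)`. -/
noncomputable def Dop {Ω : Type*} [MeasurableSpace Ω] (ν : Measure Ω) [IsFiniteMeasure ν]
    {A B : Set Ω} (hA : MeasurableSet A) (hB : MeasurableSet B) :
    Lp ℂ 2 ν →L[ℂ] Lp ℂ 2 ν :=
  (innerSL ℂ (chi ν hB)).smulRight (chi ν hA)

lemma chi_union {Ω : Type*} [MeasurableSpace Ω] (ν : Measure Ω) [IsFiniteMeasure ν]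
    {A B : Set Ω} (hA : MeasurableSet A) (hB : MeasurableSet B) (h : Disjoint A B) :
    chi ν (hA.union hB) = chi ν hA + chi ν hB :=
  indicatorConstLp_disjoint_union hA hB (measure_ne_top ν A) (measure_ne_top ν B) h 1

lemma sum_chi {Ω ι : Type*} [MeasurableSpace Ω] (ν : Measure Ω) [IsFiniteMeasure ν]
    {A : ι → Set Ω} (hA : ∀ i, MeasurableSet (A i))
    (hdisj : Pairwise (Function.onFun Disjoint A)) (s : Finset ι) :
    ∑ i ∈ s, chi ν (hA i) = chi ν (s.measurableSet_biUnion fun i _ => hA i) := by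
  classical
  induction s using Finset.induction_on with
  | empty => simp [chi]
  | insert a s ha ih =>
    have hd : Disjoint (A a) (⋃ i ∈ s, A i) :=
      Set.disjoint_iUnion₂_right.2 fun i hi => hdisj (ne_of_mem_of_not_mem hi ha).symm
    rw [Finset.sum_insert ha, ih, ← chi_union ν _ _ hd]
    simp only [Finset.set_biUnion_insert]

lemma hasSum_chi {Ω ι : Type*} [Countable ι] [MeasurableSpace Ω] (ν : Measure Ω)
    [IsFiniteMeasure ν] {A : ι → Set Ω} (hA : ∀ i, MeasurableSet (A i))
    (hdisj : Pairwise (Function.onFun Disjoint A)) :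
    HasSum (fun i => chi ν (hA i)) (chi ν (MeasurableSet.iUnion hA)) := by
  simp only [HasSum, SummationFilter.unconditional_filter, sum_chi ν hA hdisj]
  refine tendsto_indicatorConstLp_set (by simp) ?_
  have hfin : ∑' i, ν (A i) ≠ ⊤ := by
    rw [← measure_iUnion hdisj hA]
    exact measure_ne_top _ _
  refine tendsto_of_tendsto_of_tendsto_of_le_of_le tendsto_const_nhds
    (ENNReal.tendsto_tsum_compl_atTop_zero hfin) (fun _ => zero_le) fun s => ?_
  refine (measure_mono ?_).trans (measure_iUnion_le fun i : {x // x ∉ s} => A i)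
  rintro x (⟨hx, hx'⟩ | ⟨hx, hx'⟩)
  · obtain ⟨i, -, hi⟩ := Set.mem_iUnion₂.1 hx
    exact absurd (Set.mem_iUnion.2 ⟨i, hi⟩) hx'
  · obtain ⟨i, hi⟩ := Set.mem_iUnion.1 hx
    exact Set.mem_iUnion.2 ⟨⟨i, fun his => hx' (Set.mem_iUnion₂.2 ⟨i, his, hi⟩)⟩, hi⟩

/-- For fixed `B`, `A ↦ D(A,B)` is a countably additive operator-valued measure:
for mutually disjoint `A_i`, `∑ D(A_i,B)` converges in operator norm to `D(∪A_i, B)`. -/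
theorem stmt4 {Ω : Type*} [MeasurableSpace Ω] (ν : Measure Ω) [IsProbabilityMeasure ν]
    (A : ℕ → Set Ω) (hA : ∀ i, MeasurableSet (A i))
    (hdisj : Pairwise (Function.onFun Disjoint A))
    {B : Set Ω} (hB : MeasurableSet B) :
    HasSum (fun i => Dop ν (hA i) hB) (Dop ν (MeasurableSet.iUnion hA) hB) :=
  (ContinuousLinearMap.smulRightL ℂ _ _ (innerSL ℂ (chi ν hB))).hasSum (hasSum_chi ν hA hdisj)
end

section
/- Let (Ω, 𝒜, ν) be a probability space and H = L²(Ω, ν). If A_1 ⊆ A_2 ⊆ ⋯ is an increasing sequence in 𝒜 with A = ∪_i A_i, then the q-measure operators μ(A_i) converge to μ(A) in the operator norm topology, with the quantitative bound ‖μ(A_i) − μ(A)‖ ≤ 2·ν(A)^{1/2}·(ν(A) − ν(A_i))^{1/2}; similarly, for a decreasing sequence B_1 ⊇ B_2 ⊇ ⋯ in 𝒜, μ(B_i) converges in operator norm to μ(∩_i B_i). -/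
open MeasureTheory

open InnerProductSpace in
theorem norm_rankOne_self_sub_rankOne_self_le {𝕜 E : Type*} [RCLike 𝕜] [NormedAddCommGroup E]
    [InnerProductSpace 𝕜 E] (x y : E) :
    ‖rankOne 𝕜 x x - rankOne 𝕜 y y‖ ≤ (‖x‖ + ‖y‖) * ‖x - y‖ := by
  have h : rankOne 𝕜 x x - rankOne 𝕜 y y = rankOne 𝕜 x (x - y) + rankOne 𝕜 (x - y) y := by
    simp
  calc ‖rankOne 𝕜 x x - rankOne 𝕜 y y‖
      ≤ ‖rankOne 𝕜 x (x - y)‖ + ‖rankOne 𝕜 (x - y) y‖ := h ▸ norm_add_le _ _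
    _ = (‖x‖ + ‖y‖) * ‖x - y‖ := by
      simp only [norm_rankOne]
      ring

open InnerProductSpace in
theorem continuous_rankOne_self {𝕜 E : Type*} [RCLike 𝕜] [NormedAddCommGroup E]
    [InnerProductSpace 𝕜 E] : Continuous fun x : E => rankOne 𝕜 x x := by
  refine continuous_iff_continuousAt.2 fun y => tendsto_iff_norm_sub_tendsto_zero.2 ?_
  refine squeeze_zero (fun _ => norm_nonneg _)
    (fun x => norm_rankOne_self_sub_rankOne_self_le x y) ?_
  have hc : Continuous fun x : E => (‖x‖ + ‖y‖) * ‖x - y‖ := by fun_prop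
  simpa using hc.tendsto y

section QMeasure

variable {Ω : Type*} [MeasurableSpace Ω] {ν : Measure Ω} [IsFiniteMeasure ν] {s t : Set Ω}

theorem norm_chi (hs : MeasurableSet s) : ‖chi ν hs‖ = √(ν s).toReal := by
  rw [chi, norm_indicatorConstLp two_ne_zero ENNReal.ofNat_ne_top, Real.sqrt_eq_rpow]
  simp [Measure.real]

theorem norm_chi_sub_chi (hs : MeasurableSet s) (ht : MeasurableSet t) (hst : s ⊆ t) :
    ‖chi ν hs - chi ν ht‖ = √((ν t).toReal - (ν s).toReal) := by
  have h : chi ν ht = chi ν hs + chi ν (ht.diff hs) := by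
    have := indicatorConstLp_disjoint_union (p := 2) hs (ht.diff hs) (measure_ne_top ν s)
      (measure_ne_top ν (t \ s)) Set.disjoint_sdiff_right (1 : ℂ)
    simpa only [Set.union_sdiff_cancel hst, chi] using this
  rw [h, sub_add_cancel_left, norm_neg, norm_chi]
  congr 1
  exact measureReal_sdiff hst hs

theorem norm_Dop_sub_Dop_le (hs : MeasurableSet s) (ht : MeasurableSet t) (hst : s ⊆ t) :
    ‖Dop ν hs hs - Dop ν ht ht‖
      ≤ 2 * √(ν t).toReal * √((ν t).toReal - (ν s).toReal) := by
  have hle : √(ν s).toReal ≤ √(ν t).toReal :=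
    Real.sqrt_le_sqrt (measureReal_mono hst)
  refine (norm_rankOne_self_sub_rankOne_self_le (𝕜 := ℂ) (chi ν hs) (chi ν ht)).trans ?_
  rw [norm_chi, norm_chi, norm_chi_sub_chi hs ht hst]
  gcongr
  linarith

theorem tendsto_Dop_of_tendsto_chi {ι : Type*} {l : Filter ι} {u : ι → Set Ω}
    (hu : ∀ i, MeasurableSet (u i)) (ht : MeasurableSet t)
    (h : Filter.Tendsto (fun i => chi ν (hu i)) l (nhds (chi ν ht))) :
    Filter.Tendsto (fun i => Dop ν (hu i) (hu i)) l (nhds (Dop ν ht ht)) :=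
  (continuous_rankOne_self.tendsto (chi ν ht)).comp h

theorem tendsto_chi {ι : Type*} {l : Filter ι} {u : ι → Set Ω}
    (hu : ∀ i, MeasurableSet (u i)) (ht : MeasurableSet t)
    (h : Filter.Tendsto (fun i => ν (symmDiff (u i) t)) l (nhds 0)) :
    Filter.Tendsto (fun i => chi ν (hu i)) l (nhds (chi ν ht)) :=
  tendsto_indicatorConstLp_set ENNReal.ofNat_ne_top h

end QMeasure

/-- Continuity of the q-measure operator `μ(A) = D(A,A)`: for increasing `A_i` with
`A = ∪A_i`, `‖μ(A_i) − μ(A)‖ ≤ 2 ν(A)^{1/2} (ν(A)−ν(A_i))^{1/2}` and `μ(A_i) → μ(A)`;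
for decreasing `B_i`, `μ(B_i) → μ(∩B_i)` in operator norm. -/
theorem stmt8 {Ω : Type*} [MeasurableSpace Ω] (ν : Measure Ω) [IsProbabilityMeasure ν] :
    (∀ (A : ℕ → Set Ω) (hA : ∀ i, MeasurableSet (A i)), Monotone A →
      (∀ i, ‖Dop ν (hA i) (hA i) - Dop ν (MeasurableSet.iUnion hA) (MeasurableSet.iUnion hA)‖
          ≤ 2 * Real.sqrt (ν (⋃ i, A i)).toReal
              * Real.sqrt ((ν (⋃ i, A i)).toReal - (ν (A i)).toReal)) ∧
      Filter.Tendsto (fun i => Dop ν (hA i) (hA i)) Filter.atTop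
        (nhds (Dop ν (MeasurableSet.iUnion hA) (MeasurableSet.iUnion hA)))) ∧
    (∀ (B : ℕ → Set Ω) (hB : ∀ i, MeasurableSet (B i)), Antitone B →
      Filter.Tendsto (fun i => Dop ν (hB i) (hB i)) Filter.atTop
        (nhds (Dop ν (MeasurableSet.iInter hB) (MeasurableSet.iInter hB)))) := by
  refine ⟨fun A hA hmono => ⟨fun i =>
      norm_Dop_sub_Dop_le (hA i) (.iUnion hA) (Set.subset_iUnion A i), ?_⟩, fun B hB hanti => ?_⟩
  · refine tendsto_Dop_of_tendsto_chi hA _ (tendsto_chi hA _ ?_)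
    have h := ENNReal.Tendsto.sub (tendsto_const_nhds (x := ν (⋃ i, A i)))
      (tendsto_measure_iUnion_atTop (μ := ν) hmono) (.inl (measure_ne_top ν _))
    rw [tsub_self] at h
    refine h.congr fun i => ?_
    rw [symmDiff_of_le (Set.subset_iUnion A i),
      measure_sdiff (Set.subset_iUnion A i) (hA i).nullMeasurableSet (measure_ne_top ν _),
      Function.comp_apply]
  · refine tendsto_Dop_of_tendsto_chi hB _ (tendsto_chi hB _ ?_)
    have h := ENNReal.Tendsto.sub
      (tendsto_measure_iInter_atTop (μ := ν) (fun i => (hB i).nullMeasurableSet) hanti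
        ⟨0, measure_ne_top ν _⟩)
      (tendsto_const_nhds (x := ν (⋂ i, B i))) (.inl (measure_ne_top ν _))
    rw [tsub_self] at h
    refine h.congr fun i => ?_
    rw [symmDiff_of_ge (Set.iInter_subset B i),
      measure_sdiff (Set.iInter_subset B i) (MeasurableSet.iInter hB).nullMeasurableSet
        (measure_ne_top ν _), Function.comp_apply]
end

section
/- Let (Ω, 𝒜, ν) be a probability space, H = L²(Ω, ν), and let f : Ω → ℝ be a measurable function with f ≥ 0 and ∫ f² dν < ∞. Then for every g ∈ H, the function y ↦ ∫ min(f(x), f(y))·g(x) dν(x) is well defined and lies in H, and the resulting quantization operator f̂ : H → H, (f̂ g)(y) = ∫ min(f(x), f(y))·g(x) dν(x), is a bounded linear operator with operator norm ‖f̂‖ ≤ ‖f‖_{L²(ν)}; moreover f̂ is self-adjoint. -/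
open MeasureTheory

section MinKernel

theorem norm_min_mul_le {Ω : Type*} {f : Ω → ℝ} (hf0 : 0 ≤ f) (x y : Ω) (z : ℂ) :
    ‖((min (f x) (f y) : ℝ) : ℂ) * z‖ ≤ f y * ‖z‖ := by
  rw [norm_mul, Complex.norm_real, Real.norm_of_nonneg (le_min (hf0 x) (hf0 y))]
  gcongr
  exact min_le_right _ _

variable {Ω : Type*} [MeasurableSpace Ω] {ν : Measure Ω}

theorem integral_norm_le_norm_Lp_two [IsProbabilityMeasure ν] (g : Lp ℂ 2 ν) :
    ∫ x, ‖g x‖ ∂ν ≤ ‖g‖ := by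
  rw [integral_norm_eq_lintegral_enorm (Lp.aestronglyMeasurable g),
    ← eLpNorm_one_eq_lintegral_enorm, Lp.norm_def]
  exact ENNReal.toReal_mono (Lp.eLpNorm_ne_top g)
    (eLpNorm_le_eLpNorm_of_exponent_le (by norm_num) (Lp.aestronglyMeasurable g))

theorem norm_toLp_two_eq_sqrt_integral_sq {f : Ω → ℝ} (hf : MemLp f 2 ν) :
    ‖hf.toLp f‖ = Real.sqrt (∫ x, f x ^ 2 ∂ν) := by
  rw [Lp.norm_toLp, hf.eLpNorm_eq_integral_rpow_norm (by norm_num) (by norm_num),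
    ENNReal.toReal_ofReal (by positivity), Real.sqrt_eq_rpow]
  simp

theorem stronglyMeasurable_min_mul {f : Ω → ℝ} (hfm : Measurable f) (g : Lp ℂ 2 ν) :
    StronglyMeasurable fun p : Ω × Ω => ((min (f p.2) (f p.1) : ℝ) : ℂ) * g p.2 := by
  have hg : Measurable g := (Lp.stronglyMeasurable g).measurable
  exact Measurable.stronglyMeasurable (by fun_prop)

theorem integrable_min_mul [IsFiniteMeasure ν] {f : Ω → ℝ} (hfm : Measurable f) (hf0 : 0 ≤ f)
    (g : Lp ℂ 2 ν) (y : Ω) :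
    Integrable (fun x => ((min (f x) (f y) : ℝ) : ℂ) * g x) ν := by
  have hg : Integrable g ν := (Lp.memLp g).integrable (by norm_num)
  refine (hg.norm.const_mul (f y)).mono' ?_ (.of_forall fun x => norm_min_mul_le hf0 x y _)
  exact ((stronglyMeasurable_min_mul hfm g).comp_measurable
    (measurable_prodMk_left (x := y))).aestronglyMeasurable

theorem norm_integral_min_mul_le [IsProbabilityMeasure ν] {f : Ω → ℝ} (hf0 : 0 ≤ f)
    (g : Lp ℂ 2 ν) (y : Ω) :
    ‖∫ x, ((min (f x) (f y) : ℝ) : ℂ) * g x ∂ν‖ ≤ ‖g‖ * ‖f y‖ := by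
  have hg : Integrable g ν := (Lp.memLp g).integrable (by norm_num)
  calc ‖∫ x, ((min (f x) (f y) : ℝ) : ℂ) * g x ∂ν‖
      ≤ ∫ x, f y * ‖g x‖ ∂ν := norm_integral_le_of_norm_le (hg.norm.const_mul _)
        (.of_forall fun x => norm_min_mul_le hf0 x y _)
    _ = f y * ∫ x, ‖g x‖ ∂ν := integral_const_mul _ _
    _ ≤ f y * ‖g‖ := mul_le_mul_of_nonneg_left (integral_norm_le_norm_Lp_two g) (hf0 y)
    _ = ‖g‖ * ‖f y‖ := by rw [Real.norm_of_nonneg (hf0 y), mul_comm]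

theorem memLp_integral_min_mul [IsProbabilityMeasure ν] {f : Ω → ℝ} (hfm : Measurable f)
    (hf0 : 0 ≤ f) (hf : MemLp f 2 ν) (g : Lp ℂ 2 ν) :
    MemLp (fun y => ∫ x, ((min (f x) (f y) : ℝ) : ℂ) * g x ∂ν) 2 ν :=
  hf.of_le_mul (stronglyMeasurable_min_mul hfm g).integral_prod_right.aestronglyMeasurable
    (.of_forall fun y => norm_integral_min_mul_le hf0 g y)

/-- The integral operator on `L²` with kernel `min (f x) (f y)`. -/
noncomputable def minKernelOp [IsProbabilityMeasure ν] {f : Ω → ℝ} (hfm : Measurable f)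
    (hf0 : 0 ≤ f) (hf : MemLp f 2 ν) : Lp ℂ 2 ν →L[ℂ] Lp ℂ 2 ν :=
  LinearMap.mkContinuous
    { toFun := fun g => (memLp_integral_min_mul hfm hf0 hf g).toLp _
      map_add' := fun g h => by
        rw [← MemLp.toLp_add]
        refine MemLp.toLp_congr _ _ (.of_forall fun y => ?_)
        simp only [Pi.add_apply]
        rw [← integral_add (integrable_min_mul hfm hf0 g y) (integrable_min_mul hfm hf0 h y)]
        refine integral_congr_ae ?_
        filter_upwards [Lp.coeFn_add g h] with x hx
        rw [hx, Pi.add_apply, mul_add]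
      map_smul' := fun c g => by
        rw [RingHom.id_apply, ← MemLp.toLp_const_smul]
        refine MemLp.toLp_congr _ _ (.of_forall fun y => ?_)
        simp only [Pi.smul_apply]
        rw [← integral_smul]
        refine integral_congr_ae ?_
        filter_upwards [Lp.coeFn_smul c g] with x hx
        rw [hx, Pi.smul_apply, mul_smul_comm] }
    ‖hf.toLp f‖ fun g => by
      rw [mul_comm]
      refine Lp.norm_le_mul_norm_of_ae_le_mul ?_
      filter_upwards [(memLp_integral_min_mul hfm hf0 hf g).coeFn_toLp, hf.coeFn_toLp]
        with y hy hfy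
      simp only [LinearMap.coe_mk, AddHom.coe_mk]
      rw [hy, hfy]
      exact norm_integral_min_mul_le hf0 g y

theorem coeFn_minKernelOp [IsProbabilityMeasure ν] {f : Ω → ℝ} (hfm : Measurable f)
    (hf0 : 0 ≤ f) (hf : MemLp f 2 ν) (g : Lp ℂ 2 ν) :
    (minKernelOp hfm hf0 hf g : Ω → ℂ) =ᵐ[ν]
      fun y => ∫ x, ((min (f x) (f y) : ℝ) : ℂ) * g x ∂ν :=
  (memLp_integral_min_mul hfm hf0 hf g).coeFn_toLp

theorem integrable_prod_conj_mul_min_mul [IsFiniteMeasure ν] {f : Ω → ℝ} (hfm : Measurable f)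
    (hf0 : 0 ≤ f) (hf : MemLp f 2 ν) (g h : Lp ℂ 2 ν) :
    Integrable (fun p : Ω × Ω =>
      starRingEnd ℂ (h p.1) * (((min (f p.2) (f p.1) : ℝ) : ℂ) * g p.2)) (ν.prod ν) := by
  have hg : Integrable g ν := (Lp.memLp g).integrable (by norm_num)
  have hfh : Integrable (fun y => f y * ‖h y‖) ν := hf.integrable_mul (Lp.memLp h).norm
  have hh : Measurable h := (Lp.stronglyMeasurable h).measurable
  have hconj : Measurable fun p : Ω × Ω => starRingEnd ℂ (h p.1) :=
    Complex.continuous_conj.measurable.comp (hh.comp measurable_fst)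
  refine (hfh.mul_prod hg.norm).mono'
    (hconj.stronglyMeasurable.mul (stronglyMeasurable_min_mul hfm g)).aestronglyMeasurable
    (.of_forall fun p => ?_)
  rw [norm_mul, RCLike.norm_conj]
  calc ‖h p.1‖ * ‖((min (f p.2) (f p.1) : ℝ) : ℂ) * g p.2‖
      ≤ ‖h p.1‖ * (f p.1 * ‖g p.2‖) := by
        gcongr
        exact norm_min_mul_le hf0 _ _ _
    _ = f p.1 * ‖h p.1‖ * ‖g p.2‖ := by ring

theorem isSelfAdjoint_minKernelOp [IsProbabilityMeasure ν] {f : Ω → ℝ} (hfm : Measurable f)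
    (hf0 : 0 ≤ f) (hf : MemLp f 2 ν) : IsSelfAdjoint (minKernelOp hfm hf0 hf) := by
  rw [ContinuousLinearMap.isSelfAdjoint_iff_isSymmetric]
  intro h g
  simp only [ContinuousLinearMap.coe_coe]
  have hleft : inner ℂ (minKernelOp hfm hf0 hf h) g =
      ∫ x, ∫ y, starRingEnd ℂ (h y) * (((min (f x) (f y) : ℝ) : ℂ) * g x) ∂ν ∂ν := by
    rw [L2.inner_def]
    refine integral_congr_ae ?_
    filter_upwards [coeFn_minKernelOp hfm hf0 hf h] with x hx
    rw [hx, RCLike.inner_apply, ← integral_conj, ← integral_const_mul]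
    congr 1 with y
    rw [map_mul, Complex.conj_ofReal, min_comm]
    ring
  have hright : inner ℂ h (minKernelOp hfm hf0 hf g) =
      ∫ y, ∫ x, starRingEnd ℂ (h y) * (((min (f x) (f y) : ℝ) : ℂ) * g x) ∂ν ∂ν := by
    rw [L2.inner_def]
    refine integral_congr_ae ?_
    filter_upwards [coeFn_minKernelOp hfm hf0 hf g] with y hy
    rw [hy, RCLike.inner_apply, mul_comm, ← integral_const_mul]
  rw [hleft, hright]
  exact (integral_integral_swap (integrable_prod_conj_mul_min_mul hfm hf0 hf g h)).symm

end MinKernel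

/-- For a nonnegative random variable `f` with `∫ f² dν < ∞`, the quantization
`(f̂ g)(y) = ∫ min(f(x), f(y)) g(x) dν(x)` is well defined, maps `H` into `H`, and gives a
bounded self-adjoint operator with `‖f̂‖ ≤ ‖f‖_{L²}`. -/
theorem stmt15 {Ω : Type*} [MeasurableSpace Ω] (ν : Measure Ω) [IsProbabilityMeasure ν]
    (f : Ω → ℝ) (hfm : Measurable f) (hf0 : 0 ≤ f)
    (hf2 : Integrable (fun x => f x ^ 2) ν) :
    (∀ (g : Lp ℂ 2 ν) (y : Ω), Integrable (fun x => ((min (f x) (f y) : ℝ) : ℂ) * g x) ν) ∧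
    ∃ T : Lp ℂ 2 ν →L[ℂ] Lp ℂ 2 ν,
      (∀ g : Lp ℂ 2 ν,
        (T g : Ω → ℂ) =ᵐ[ν] fun y => ∫ x, ((min (f x) (f y) : ℝ) : ℂ) * g x ∂ν) ∧
      ‖T‖ ≤ Real.sqrt (∫ x, f x ^ 2 ∂ν) ∧
      IsSelfAdjoint T := by
  have hf : MemLp f 2 ν := (memLp_two_iff_integrable_sq hfm.aestronglyMeasurable).2 hf2
  refine ⟨integrable_min_mul hfm hf0, minKernelOp hfm hf0 hf, coeFn_minKernelOp hfm hf0 hf, ?_,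
    isSelfAdjoint_minKernelOp hfm hf0 hf⟩
  rw [← norm_toLp_two_eq_sqrt_integral_sq hf]
  exact LinearMap.mkContinuous_norm_le _ (norm_nonneg _) _
end

section
/- Let (Ω, 𝒜, ν) be a probability space and H = L²(Ω, ν). For nonnegative square-integrable random variables f and g, the quantization map is 2-Lipschitz in operator norm: ‖f̂ − ĝ‖ ≤ 2·‖f − g‖_{L²(ν)}. Consequently, if 0 ≤ f_1 ≤ f_2 ≤ ⋯ is an increasing sequence of nonnegative square-integrable random variables converging pointwise to a square-integrable random variable f, then f̂_i converges to f̂ in the operator norm topology. -/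
open MeasureTheory

/-- Cauchy–Schwarz for real square-integrable functions. -/
theorem integral_mul_le_norm_toLp_mul_norm_toLp {Ω : Type*} [MeasurableSpace Ω] {ν : Measure Ω}
    {a b : Ω → ℝ} (ha : MemLp a 2 ν) (hb : MemLp b 2 ν) :
    ∫ x, a x * b x ∂ν ≤ ‖ha.toLp a‖ * ‖hb.toLp b‖ := by
  refine le_trans (le_of_eq ?_) (real_inner_le_norm (ha.toLp a) (hb.toLp b))
  rw [L2.inner_def]
  refine integral_congr_ae ?_
  filter_upwards [ha.coeFn_toLp, hb.coeFn_toLp] with x hxa hxb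
  simp [hxa, hxb, mul_comm]

theorem norm_toLp_abs_eq_sqrt {Ω : Type*} [MeasurableSpace Ω] {ν : Measure Ω}
    {d : Ω → ℝ} (hd : MemLp (fun x => |d x|) 2 ν) :
    ‖hd.toLp (fun x => |d x|)‖ = Real.sqrt (∫ x, d x ^ 2 ∂ν) := by
  rw [@norm_eq_sqrt_real_inner, L2.inner_def]
  congr 1
  refine integral_congr_ae ?_
  filter_upwards [hd.coeFn_toLp] with x hx
  simp [hx]

theorem abs_min_sub_min_le_add (a b c d : ℝ) : |min a b - min c d| ≤ |a - c| + |b - d| :=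
  (abs_min_sub_min_le_max a b c d).trans
    (max_le (le_add_of_nonneg_right (abs_nonneg _)) (le_add_of_nonneg_left (abs_nonneg _)))

/-- For fixed `c ≥ 0`, the section `x ↦ min (f x) c` of the quantization kernel is integrable
against any square-integrable function. -/
theorem integrable_min_mul_s17 {Ω : Type*} [MeasurableSpace Ω] {ν : Measure Ω}
    {f : Ω → ℝ} (hf : MemLp f 2 ν) (hm : Measurable f) (h0 : 0 ≤ f) {c : ℝ} (hc : 0 ≤ c)
    (u : Lp ℂ 2 ν) : Integrable (fun x => ((min (f x) c : ℝ) : ℂ) * u x) ν := by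
  have h : MemLp (fun x => ((min (f x) c : ℝ) : ℂ)) 2 ν := by
    refine hf.mono (by fun_prop) (Filter.Eventually.of_forall fun x => ?_)
    rw [Complex.norm_real, Real.norm_of_nonneg (le_min (h0 x) hc), Real.norm_of_nonneg (h0 x)]
    exact min_le_left _ _
  exact h.integrable_mul (Lp.memLp u)

theorem norm_sub_le_of_min_kernel {Ω : Type*} [MeasurableSpace Ω] (ν : Measure Ω)
    [IsProbabilityMeasure ν] (f g : Ω → ℝ) (hf : Measurable f) (hg : Measurable g)
    (hf0 : 0 ≤ f) (hg0 : 0 ≤ g)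
    (hf2 : Integrable (fun x => f x ^ 2) ν) (hg2 : Integrable (fun x => g x ^ 2) ν)
    (T S : Lp ℂ 2 ν →L[ℂ] Lp ℂ 2 ν)
    (hT : ∀ u : Lp ℂ 2 ν,
      (T u : Ω → ℂ) =ᵐ[ν] fun y => ∫ x, ((min (f x) (f y) : ℝ) : ℂ) * u x ∂ν)
    (hS : ∀ u : Lp ℂ 2 ν,
      (S u : Ω → ℂ) =ᵐ[ν] fun y => ∫ x, ((min (g x) (g y) : ℝ) : ℂ) * u x ∂ν) :
    ‖T - S‖ ≤ 2 * Real.sqrt (∫ x, (f x - g x) ^ 2 ∂ν) := by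
  have hfL : MemLp f 2 ν := (memLp_two_iff_integrable_sq hf.aestronglyMeasurable).2 hf2
  have hgL : MemLp g 2 ν := (memLp_two_iff_integrable_sq hg.aestronglyMeasurable).2 hg2
  have hd : MemLp (fun x => |f x - g x|) 2 ν := (hfL.sub hgL).norm
  have hD := norm_toLp_abs_eq_sqrt hd
  set D := hd.toLp (fun x => |f x - g x|)
  rw [← hD]
  refine ContinuousLinearMap.opNorm_le_bound _ (by positivity) fun u => ?_
  have hu : MemLp (fun x => ‖u x‖) 2 ν := (Lp.memLp u).norm
  have hU : ‖hu.toLp (fun x => ‖u x‖)‖ = ‖u‖ := by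
    rw [Lp.norm_toLp, eLpNorm_norm, Lp.norm_def]
  have h1 : MemLp (fun _ : Ω => (1 : ℝ)) 2 ν := memLp_const 1
  have hC : ‖h1.toLp (fun _ : Ω => (1 : ℝ))‖ = 1 := by
    rw [Lp.norm_toLp, eLpNorm_const _ (by simp) (IsProbabilityMeasure.ne_zero ν)]
    simp
  have hdu : ∫ x, |f x - g x| * ‖u x‖ ∂ν ≤ ‖D‖ * ‖u‖ := by
    simpa only [hU] using integral_mul_le_norm_toLp_mul_norm_toLp hd hu
  have hu1 : ∫ x, ‖u x‖ ∂ν ≤ ‖u‖ := by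
    simpa only [hU, hC, one_mul] using integral_mul_le_norm_toLp_mul_norm_toLp h1 hu
  have hduI : Integrable (fun x => |f x - g x| * ‖u x‖) ν := hd.integrable_mul hu
  have huI : Integrable (fun x => ‖u x‖) ν := hu.integrable (by norm_num)
  have key : ∀ y, ‖(∫ x, ((min (f x) (f y) : ℝ) : ℂ) * u x ∂ν)
      - ∫ x, ((min (g x) (g y) : ℝ) : ℂ) * u x ∂ν‖ ≤ ‖D‖ * ‖u‖ + ‖u‖ * |f y - g y| := by
    intro y
    rw [← integral_sub (integrable_min_mul_s17 hfL hf hf0 (hf0 y) u)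
      (integrable_min_mul_s17 hgL hg hg0 (hg0 y) u)]
    calc _ ≤ ∫ x, (|f x - g x| * ‖u x‖ + ‖u x‖ * |f y - g y|) ∂ν := by
          refine norm_integral_le_of_norm_le (hduI.add (huI.mul_const _))
            (Filter.Eventually.of_forall fun x => ?_)
          rw [← sub_mul, ← Complex.ofReal_sub, norm_mul, Complex.norm_real, Real.norm_eq_abs,
            mul_comm ‖u x‖, ← add_mul]
          gcongr
          exact abs_min_sub_min_le_add _ _ _ _
      _ = (∫ x, |f x - g x| * ‖u x‖ ∂ν) + (∫ x, ‖u x‖ ∂ν) * |f y - g y| := by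
          rw [integral_add hduI (huI.mul_const _), integral_mul_const]
      _ ≤ _ := by gcongr
  have hle : ‖(T - S) u‖ ≤
      ‖(‖D‖ * ‖u‖) • h1.toLp (fun _ : Ω => (1 : ℝ)) + ‖u‖ • D‖ := by
    refine Lp.norm_le_norm_of_ae_le ?_
    rw [sub_apply]
    filter_upwards [Lp.coeFn_sub (T u) (S u), hT u, hS u,
      Lp.coeFn_add ((‖D‖ * ‖u‖) • h1.toLp (fun _ : Ω => (1 : ℝ))) (‖u‖ • D),
      Lp.coeFn_smul (‖D‖ * ‖u‖) (h1.toLp (fun _ : Ω => (1 : ℝ))), Lp.coeFn_smul ‖u‖ D,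
      h1.coeFn_toLp, hd.coeFn_toLp] with y e1 e2 e3 e4 e5 e6 e7 e8
    rw [e1, Pi.sub_apply, e2, e3, e4, Pi.add_apply, e5, e6, Pi.smul_apply, Pi.smul_apply, e7, e8,
      smul_eq_mul, smul_eq_mul, mul_one]
    exact (key y).trans (le_abs_self _)
  calc ‖(T - S) u‖ ≤ _ := hle
    _ ≤ ‖(‖D‖ * ‖u‖) • h1.toLp (fun _ : Ω => (1 : ℝ))‖ + ‖‖u‖ • D‖ := norm_add_le _ _
    _ = 2 * ‖D‖ * ‖u‖ := by
      rw [norm_smul, norm_smul, hC, norm_mul, norm_norm, norm_norm]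
      ring

/-- Quantization is 2-Lipschitz in operator norm: `‖f̂ − ĝ‖ ≤ 2‖f − g‖_{L²}`; consequently,
if `0 ≤ f₁ ≤ f₂ ≤ ⋯` increases pointwise to `f`, then `f̂ᵢ → f̂` in operator norm. -/
theorem stmt17 {Ω : Type*} [MeasurableSpace Ω] (ν : Measure Ω) [IsProbabilityMeasure ν] :
    (∀ (f g : Ω → ℝ), Measurable f → Measurable g → 0 ≤ f → 0 ≤ g →
      Integrable (fun x => f x ^ 2) ν → Integrable (fun x => g x ^ 2) ν →
      ∀ T S : Lp ℂ 2 ν →L[ℂ] Lp ℂ 2 ν,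
      (∀ u : Lp ℂ 2 ν,
        (T u : Ω → ℂ) =ᵐ[ν] fun y => ∫ x, ((min (f x) (f y) : ℝ) : ℂ) * u x ∂ν) →
      (∀ u : Lp ℂ 2 ν,
        (S u : Ω → ℂ) =ᵐ[ν] fun y => ∫ x, ((min (g x) (g y) : ℝ) : ℂ) * u x ∂ν) →
      ‖T - S‖ ≤ 2 * Real.sqrt (∫ x, (f x - g x) ^ 2 ∂ν)) ∧
    (∀ (f : Ω → ℝ) (fs : ℕ → Ω → ℝ), Measurable f → (∀ i, Measurable (fs i)) →
      (∀ i, 0 ≤ fs i) → (∀ i, fs i ≤ fs (i + 1)) →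
      (∀ x, Filter.Tendsto (fun i => fs i x) Filter.atTop (nhds (f x))) →
      Integrable (fun x => f x ^ 2) ν → (∀ i, Integrable (fun x => fs i x ^ 2) ν) →
      ∀ (T : Lp ℂ 2 ν →L[ℂ] Lp ℂ 2 ν) (Ts : ℕ → Lp ℂ 2 ν →L[ℂ] Lp ℂ 2 ν),
      (∀ u : Lp ℂ 2 ν,
        (T u : Ω → ℂ) =ᵐ[ν] fun y => ∫ x, ((min (f x) (f y) : ℝ) : ℂ) * u x ∂ν) →
      (∀ (i : ℕ) (u : Lp ℂ 2 ν),
        (Ts i u : Ω → ℂ) =ᵐ[ν] fun y => ∫ x, ((min (fs i x) (fs i y) : ℝ) : ℂ) * u x ∂ν) →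
      Filter.Tendsto Ts Filter.atTop (nhds T)) := by
  refine ⟨fun f g hf hg hf0 hg0 hf2 hg2 T S hT hS =>
    norm_sub_le_of_min_kernel ν f g hf hg hf0 hg0 hf2 hg2 T S hT hS, ?_⟩
  intro f fs hf hfs h0 hmono hlim hf2 hfs2 T Ts hT hTs
  have hle : ∀ i x, fs i x ≤ f x := fun i x =>
    (monotone_nat_of_le_succ fun n => hmono n x).ge_of_tendsto (hlim x) i
  have hf0 : 0 ≤ f := fun x => (h0 0 x).trans (hle 0 x)
  have hint : Filter.Tendsto (fun i => ∫ x, (fs i x - f x) ^ 2 ∂ν) Filter.atTop (nhds 0) := by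
    rw [← integral_zero Ω ℝ (μ := ν)]
    refine tendsto_integral_of_dominated_convergence (fun x => f x ^ 2)
      (fun i => (((hfs i).sub hf).pow_const 2).aestronglyMeasurable) hf2
      (fun i => Filter.Eventually.of_forall fun x => ?_)
      (Filter.Eventually.of_forall fun x => ?_)
    · have h0x : 0 ≤ fs i x := h0 i x
      rw [Real.norm_of_nonneg (sq_nonneg _)]
      exact sq_le_sq' (by linarith) (by linarith [hle i x])
    · simpa using ((hlim x).sub_const (f x)).pow 2
  rw [tendsto_iff_norm_sub_tendsto_zero]
  refine squeeze_zero (fun i => norm_nonneg _) (fun i => norm_sub_le_of_min_kernel ν (fs i) f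
    (hfs i) hf (h0 i) hf0 (hfs2 i) hf2 (Ts i) T (hTs i) hT) ?_
  simpa using (hint.sqrt).const_mul 2
end
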